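/- For the quadratic character η of F_{p^r} with p an odd prime: if p ≡ 1 (mod 4) then G(η, 1) = −(−1)^r · √(p^r), and if p ≡ 3 (mod 4) then G(η, 1) = −(−i)^r · √(p^r). -/

import Mathlib

noncomputable def eChar (p : ℕ) (F : Type*) [Field F] [Algebra (ZMod p) F] (x : F) : ℂ :=
  Complex.exp (2 * (Real.pi : ℂ) * Complex.I * ((Algebra.trace (ZMod p) F x).val : ℂ) / p)

section QuadraticLift

open Finset

/-- The complex-valued quadratic Gauss sum is the sum of the additive character over squares. -/
theorem sum_addChar_sq {F : Type*} [Field F] [Fintype F] [DecidableEq F] (hF : ringChar F ≠ 2)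
    {ψ : AddChar F ℂ} (hψ : ψ ≠ 1) :
    ∑ x, ψ (x ^ 2) = ∑ x, (quadraticChar F x : ℂ) * ψ x := by
  have h : ∀ y : F, ∑ x with x ^ 2 = y, ψ (x ^ 2) = ((quadraticChar F y : ℂ) + 1) * ψ y := by
    intro y
    have hc := quadraticChar_card_sqrts hF y
    rw [sum_congr rfl (g := fun _ => ψ y) (fun x hx => by rw [(mem_filter.mp hx).2]), sum_const,
      nsmul_eq_mul]
    congr 1
    rw [Set.toFinset_ofPred] at hc
    exact_mod_cast hc
  rw [← sum_fiberwise univ (fun x : F => x ^ 2)]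
  simp_rw [h, add_mul, one_mul, sum_add_distrib, AddChar.sum_eq_zero_of_ne_one hψ, add_zero]

theorem sum_addChar_mul_sq {F : Type*} [Field F] [Fintype F] [DecidableEq F] (hF : ringChar F ≠ 2)
    {ψ : AddChar F ℂ} (hψ : ψ.IsPrimitive) {a : F} (ha : a ≠ 0) :
    ∑ x, ψ (a * x ^ 2) = quadraticChar F a * ∑ x, (quadraticChar F x : ℂ) * ψ x := by
  have h1 := sum_addChar_sq hF (hψ ha)
  simp only [AddChar.mulShift_apply] at h1
  rw [h1, mul_sum, ← Equiv.sum_comp (Equiv.mulLeft₀ a ha)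
    (fun x => (quadraticChar F a : ℂ) * ((quadraticChar F x : ℂ) * ψ x))]
  refine sum_congr rfl fun x _ => ?_
  have h2 : (quadraticChar F a : ℂ) ^ 2 = 1 := by exact_mod_cast quadraticChar_sq_one ha
  simp only [Equiv.mulLeft₀_apply, map_mul, Int.cast_mul]
  linear_combination (-(quadraticChar F x : ℂ) * ψ (a * x)) * h2

variable {K L : Type*} [Field K] [Fintype K] [DecidableEq K] [Field L] [Fintype L] [Algebra K L]

/-- Stickelberger–Pellet: the discriminant of an extension of finite fields of odd characteristic
is a square if and only if the degree is odd. -/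
theorem quadraticChar_discr (hK : ringChar K ≠ 2) {m : ℕ} (b : Module.Basis (Fin (m + 1)) K L) :
    quadraticChar K (Algebra.discr K b) = (-1) ^ m := by
  have hfin : Module.finrank K L = m + 1 := by simpa using Module.finrank_eq_card_basis b
  set q := Fintype.card K with hq
  let M : Matrix (Fin (m + 1)) (Fin (m + 1)) L := Matrix.of fun k i => b i ^ q ^ (k : ℕ)
  have hM : algebraMap K L (Algebra.discr K b) = M.det ^ 2 := by
    rw [Algebra.discr_def, RingHom.map_det, sq]
    nth_rw 1 [← Matrix.det_transpose M]
    rw [← Matrix.det_mul]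
    congr 1
    ext i j
    simp [Algebra.traceMatrix_apply, Algebra.traceForm_apply,
      FiniteField.algebraMap_trace_eq_sum_pow, Matrix.mul_apply, M, hfin, mul_pow, hq,
      Finset.sum_range]
  have hd : algebraMap K L (Algebra.discr K b) ≠ 0 := by
    simpa using Algebra.discr_not_zero_of_basis K b
  have hM0 : M.det ≠ 0 := by
    intro h
    rw [hM, h] at hd
    simp at hd
  have hfrob : M.det ^ q = (-1) ^ m * M.det := by
    have h1 := (FiniteField.frobeniusAlgHom K L).toRingHom.map_det M
    have h2 := Matrix.det_permute (finRotate (m + 1)) M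
    have h3 : (FiniteField.frobeniusAlgHom K L).toRingHom.mapMatrix M
        = M.submatrix (finRotate (m + 1)) id := by
      ext k i
      have hcard : b i ^ q ^ (m + 1) = b i := by
        have hcard := Module.card_eq_pow_finrank (K := K) (V := L)
        rw [hfin] at hcard
        rw [hq, ← hcard, FiniteField.pow_card]
      rcases Fin.eq_castSucc_or_eq_last k with ⟨k, rfl⟩ | rfl
      · simp [M, hq, ← pow_mul, pow_succ]
      · simp [M, hq, ← pow_mul, ← pow_succ]
        simpa [hq] using hcard
    rw [h3, h2, sign_finRotate] at h1
    simpa [hq] using h1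
  have hodd : 2 * (q / 2) + 1 = q := by
    have := FiniteField.odd_card_of_char_ne_two hK
    omega
  have h4 : M.det ^ (2 * (q / 2)) = (-1) ^ m := by
    apply mul_right_cancel₀ hM0
    rw [← pow_succ, hodd, hfrob]
  have h5 : ((quadraticChar K (Algebra.discr K b) : ℤ) : K) = (((-1) ^ m : ℤ) : K) := by
    apply (algebraMap K L).injective
    rw [quadraticChar_eq_pow_of_char_ne_two' hK, map_pow, hM, ← pow_mul, h4]
    simp
  have h6 : Algebra.discr K b ≠ 0 := Algebra.discr_not_zero_of_basis K b
  have hne : (-1 : K) ≠ 1 := Ring.neg_one_ne_one_of_char_ne_two hK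
  rcases quadraticChar_dichotomy h6 with h | h <;>
    rcases neg_one_pow_eq_or ℤ m with h' | h' <;> rw [h, h'] at h5 ⊢
  · simp at h5
    exact absurd h5.symm hne
  · simp at h5
    exact absurd h5 hne

/-- Davenport–Hasse relation for quadratic characters. -/
theorem quadratic_davenport_hasse (hK : ringChar K ≠ 2) [DecidableEq L] {ψ : AddChar K ℂ}
    (hψ : ψ.IsPrimitive) {n : ℕ} (hn : Module.finrank K L = n + 1) :
    ∑ x : L, (quadraticChar L x : ℂ) * ψ (Algebra.trace K L x) =
      (-1) ^ n * (∑ x : K, (quadraticChar K x : ℂ) * ψ x) ^ (n + 1) := by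
  have hL : ringChar L ≠ 2 := by rwa [← Algebra.ringChar_eq K L]
  have : Invertible (2 : K) := invertibleOfNonzero (Ring.two_ne_zero hK)
  let ψL : AddChar L ℂ := ψ.compAddMonoidHom (Algebra.trace K L).toAddMonoidHom
  have hψL : ψL ≠ 1 := by
    obtain ⟨x, hx⟩ := AddChar.ne_one_iff.mp (by simpa using hψ one_ne_zero)
    obtain ⟨y, rfl⟩ := Algebra.trace_surjective K L x
    exact AddChar.ne_one_iff.mpr ⟨y, by simpa [ψL] using hx⟩
  obtain ⟨b₀, hb₀⟩ := LinearMap.BilinForm.exists_orthogonal_basis 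
    (B := Algebra.traceForm K L) ⟨fun x y => (Algebra.traceForm_isSymm K).eq x y⟩
  let b : Module.Basis (Fin (n + 1)) K L := b₀.reindex (finCongr hn)
  have hb : ∀ i j, i ≠ j → Algebra.trace K L (b i * b j) = 0 := by
    intro i j hij
    have := LinearMap.isOrthoᵢ_def.mp hb₀ ((finCongr hn).symm i) ((finCongr hn).symm j)
      (by simpa using hij)
    simpa [b, Algebra.traceForm_apply] using this
  have hdisc : Algebra.discr K b = ∏ i, Algebra.trace K L (b i * b i) := by
    rw [Algebra.discr_def, ← Matrix.det_diagonal]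
    congr 1
    ext i j
    by_cases hij : i = j
    · subst hij
      simp [Algebra.traceMatrix_apply]
    · simp [Algebra.traceMatrix_apply, hij, hb]
  have ha : ∀ i, Algebra.trace K L (b i * b i) ≠ 0 := by
    have := Algebra.discr_not_zero_of_basis K b
    rw [hdisc, prod_ne_zero_iff] at this
    exact fun i => this i (mem_univ i)
  have htr : ∀ c : Fin (n + 1) → K, Algebra.trace K L ((b.equivFun.symm c) ^ 2) =
      ∑ i, Algebra.trace K L (b i * b i) * c i ^ 2 := by
    intro c
    rw [Module.Basis.equivFun_symm_apply, sq, sum_mul_sum, map_sum]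
    refine sum_congr rfl fun i _ => ?_
    rw [map_sum, sum_eq_single i]
    · simp only [smul_mul_smul_comm, map_smul, smul_eq_mul]
      ring
    · intro j _ hj
      simp [hb i j hj.symm]
    · simp
  calc ∑ x : L, (quadraticChar L x : ℂ) * ψ (Algebra.trace K L x)
      = ∑ x : L, ψ (Algebra.trace K L (x ^ 2)) := (sum_addChar_sq hL hψL).symm
    _ = ∑ c : Fin (n + 1) → K, ∏ i, ψ (Algebra.trace K L (b i * b i) * c i ^ 2) := by
        rw [← b.equivFun.symm.toEquiv.sum_comp]
        refine sum_congr rfl fun c _ => ?_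
        exact (congrArg ψ (htr c)).trans
          (map_prod ψ.toMonoidHom (fun i => Multiplicative.ofAdd _) univ)
    _ = ∏ i, ∑ x : K, ψ (Algebra.trace K L (b i * b i) * x ^ 2) := by
        rw [prod_univ_sum, Fintype.piFinset_univ]
    _ = _ := by
        simp_rw [sum_addChar_mul_sq hK hψ (ha _)]
        rw [prod_mul_distrib, prod_const, card_univ, Fintype.card_fin, ← Int.cast_prod, ← map_prod,
          ← hdisc, quadraticChar_discr hK]
        simp

end QuadraticLift

section GaussSign
open Finset Polynomial

/-- Iterating the operator `X * d/dX` on a polynomial divisible by `(X - 1) ^ (n + k)`. -/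
theorem iterate_euler_operator {R : Type*} [CommRing R] (n k : ℕ) (Q : R[X]) :
    ∃ S : R[X], (fun f : R[X] => X * derivative f)^[n] ((X - 1) ^ (n + k) * Q) = (X - 1) ^ k * S ∧
      (k = 0 → S.eval 1 = n.factorial * Q.eval 1) := by
  induction n generalizing Q with
  | zero => exact ⟨Q, by simp, by simp⟩
  | succ n ih =>
    obtain ⟨S, hS, hS'⟩ := ih (((n + 1 + k : ℕ) : R[X]) * X * Q + (X - 1) * X * derivative Q)
    refine ⟨S, ?_, ?_⟩
    · rw [Function.iterate_succ_apply, ← hS]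
      congr 1
      simp only [derivative_mul, derivative_pow, derivative_sub, derivative_X, derivative_one]
      rw [show n + 1 + k - 1 = n + k by omega, show n + 1 + k = n + k + 1 by omega]
      simp
      ring
    · rintro rfl
      rw [hS' rfl, Nat.factorial_succ]
      simp
      ring

theorem iterate_euler_operator_X_pow {R : Type*} [CommRing R] (n j : ℕ) (c : R) :
    (fun f : R[X] => X * derivative f)^[n] (C c * X ^ j) = C (c * j ^ n) * X ^ j := by
  induction n generalizing c with
  | zero => simp
  | succ n ih =>
    rw [Function.iterate_succ_apply]
    have : X * derivative (C c * X ^ j) = C (c * j) * X ^ j := by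
      rcases j with _ | j
      · simp
      · simp
        ring
    rw [this, ih]
    congr 2
    ring

theorem iterate_euler_operator_sub {R : Type*} [CommRing R] (n : ℕ) (f g : R[X]) :
    (fun f : R[X] => X * derivative f)^[n] (f - g) =
      (fun f : R[X] => X * derivative f)^[n] f - (fun f : R[X] => X * derivative f)^[n] g := by
  induction n generalizing f g with
  | zero => rfl
  | succ n ih => simp only [Function.iterate_succ_apply, derivative_sub, mul_sub, ih]

theorem iterate_euler_operator_sum {R ι : Type*} [CommRing R] (n : ℕ) (s : Finset ι) (f : ι → R[X]) :
    (fun f : R[X] => X * derivative f)^[n] (∑ i ∈ s, f i) =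
      ∑ i ∈ s, (fun f : R[X] => X * derivative f)^[n] (f i) := by
  induction n generalizing f with
  | zero => rfl
  | succ n ih => simp only [Function.iterate_succ_apply, derivative_sum, mul_sum, ih]

theorem X_sub_one_dvd_sub_factor (p : ℕ) (R : Type*) [CommRing R] [CharP R p] {a : ℕ} (ha : a ≤ p) :
    ∃ Q : R[X], X ^ a - X ^ (p - a) = (X - 1) * Q ∧ Q.eval 1 = 2 * a := by
  obtain ⟨Q, hQ⟩ : (X - 1 : R[X]) ∣ X ^ a - X ^ (p - a) := by
    rw [← C_1, dvd_iff_isRoot]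
    simp
  refine ⟨Q, hQ, ?_⟩
  have h := congrArg (fun f => (derivative f).eval 1) hQ
  simp [derivative_X_pow, Nat.cast_sub ha] at h
  rw [← h]
  ring

variable (p : ℕ)

/-- `∏ (ζ ^ a - ζ ^ (-a))` over `1 ≤ a ≤ (p - 1) / 2`, as a polynomial in `ζ`. -/
noncomputable def halfProd (R : Type*) [CommRing R] : R[X] :=
  ∏ a ∈ Finset.range (p / 2), (X ^ (a + 1) - X ^ (p - (a + 1)))

variable [Fact p.Prime]

theorem factorial_half_sq (hp2 : p ≠ 2) :
    (((p / 2).factorial : ℕ) : ZMod p) ^ 2 = -(-1) ^ (p / 2) := by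
  have hodd := (Fact.out : p.Prime).odd_of_ne_two hp2
  have hm : p = 2 * (p / 2) + 1 := by obtain ⟨k, hk⟩ := hodd; omega
  have h := ZMod.wilsons_lemma p
  have h2 : p - 1 = p / 2 + p / 2 := by omega
  rw [← prod_range_add_one_eq_factorial, h2, prod_range_add, Nat.cast_mul,
    prod_range_add_one_eq_factorial] at h
  have h3 : ((∏ x ∈ Finset.range (p / 2), (p / 2 + x + 1) : ℕ) : ZMod p) =
      (-1) ^ (p / 2) * ((p / 2).factorial : ℕ) := by
    rw [← prod_range_reflect, ← prod_range_add_one_eq_factorial, Nat.cast_prod, Nat.cast_prod,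
      ← card_range (p / 2), ← prod_const, card_range, ← prod_mul_distrib]
    refine prod_congr rfl fun x hx => ?_
    rw [mem_range] at hx
    have : p / 2 + (p / 2 - 1 - x) + 1 = p - (x + 1) := by omega
    rw [this, Nat.cast_sub (by omega)]
    simp
  rw [h3] at h
  have h4 : ((-1 : ZMod p) ^ (p / 2)) ^ 2 = 1 := by rw [← pow_mul, mul_comm, pow_mul]; simp
  linear_combination (-1) ^ (p / 2) * h - ((p / 2).factorial : ZMod p) ^ 2 * h4

/-- The sign in `∑ (j / p) ζ ^ j = ε ∏ (ζ ^ a - ζ ^ (-a))`. -/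
theorem sign_of_gaussSum_eq (hp2 : p ≠ 2) {ζ : ℂ} (hζ : IsPrimitiveRoot ζ p) {ε : ℤ}
    (hε : ε = 1 ∨ ε = -1)
    (h : ∑ j ∈ Finset.range p, (quadraticChar (ZMod p) (j : ZMod p) : ℂ) * ζ ^ j =
      ε * (halfProd p ℂ).eval ζ) :
    ε = ZMod.χ₈' p := by
  have hp : p.Prime := Fact.out
  have hodd := hp.odd_of_ne_two hp2
  have hm : p = 2 * (p / 2) + 1 := by obtain ⟨k, hk⟩ := hodd; omega
  have hchar : ringChar (ZMod p) ≠ 2 := by rwa [ZMod.ringChar_zmod_n]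
  set m := p / 2 with hmdef
  let f : ℤ[X] := ∑ j ∈ Finset.range p, C (quadraticChar (ZMod p) (j : ZMod p)) * X ^ j -
    C ε * halfProd p ℤ
  have hf : aeval ζ f = 0 := by
    simp [f, halfProd, eval_prod, ← hmdef, map_sum, map_prod] at h ⊢
    rw [h, sub_self]
  have hdvd : cyclotomic p ℤ ∣ f := by
    rw [cyclotomic_eq_minpoly hζ hp.pos]
    exact minpoly.isIntegrallyClosed_dvd (hζ.isIntegral hp.pos) hf
  obtain ⟨g, hg⟩ := hdvd
  have hcyc : cyclotomic p (ZMod p) = (X - 1) ^ (m + m) := by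
    have hX : (X - 1 : (ZMod p)[X]) ≠ 0 := X_sub_C_ne_zero (1 : ZMod p)
    apply mul_right_cancel₀ hX
    rw [cyclotomic_prime_mul_X_sub_one, ← pow_succ, ← two_mul, ← hm, sub_pow_char, one_pow]
  have hmap := congrArg (Polynomial.map (Int.castRingHom (ZMod p))) hg
  rw [Polynomial.map_mul, map_cyclotomic, hcyc] at hmap
  have hchoice : ∀ a : ℕ, ∃ Q : (ZMod p)[X], a < m →
      X ^ (a + 1) - X ^ (p - (a + 1)) = (X - 1) * Q ∧ Q.eval 1 = 2 * (a + 1 : ℕ) := by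
    intro a
    by_cases ha : a < m
    · obtain ⟨Q, hQ⟩ := X_sub_one_dvd_sub_factor p (ZMod p) (show a + 1 ≤ p by omega)
      exact ⟨Q, fun _ => hQ⟩
    · exact ⟨0, fun h => absurd h ha⟩
  choose Q hQ using hchoice
  have hprod : (halfProd p ℤ).map (Int.castRingHom (ZMod p)) =
      (X - 1) ^ m * ∏ a ∈ Finset.range m, Q a := by
    rw [halfProd, Polynomial.map_prod, ← hmdef]
    simp only [Polynomial.map_sub, Polynomial.map_pow, map_X]
    rw [prod_congr rfl fun a ha => (hQ a (mem_range.mp ha)).1, prod_mul_distrib, prod_const,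
      card_range]
  have hQ1 : (∏ a ∈ Finset.range m, Q a).eval 1 = 2 ^ m * (m.factorial : ZMod p) := by
    rw [eval_prod, prod_congr rfl fun a ha => (hQ a (mem_range.mp ha)).2, prod_mul_distrib,
      prod_const, card_range, ← Nat.cast_prod, prod_range_add_one_eq_factorial]
  have hD := congrArg
    (fun f => ((fun f : (ZMod p)[X] => X * derivative f)^[m] f).eval 1) hmap
  obtain ⟨S₁, hS₁, -⟩ := iterate_euler_operator m m (g.map (Int.castRingHom (ZMod p)))
  obtain ⟨S₂, hS₂, hS₂'⟩ := iterate_euler_operator m 0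
    (C (ε : ZMod p) * ∏ a ∈ Finset.range m, Q a)
  have hm0 : m ≠ 0 := by have := hp.two_le; omega
  have hmap2 : f.map (Int.castRingHom (ZMod p)) =
      ∑ j ∈ Finset.range p, C ((quadraticChar (ZMod p) (j : ZMod p) : ℤ) : ZMod p) * X ^ j -
        (X - 1) ^ (m + 0) * (C (ε : ZMod p) * ∏ a ∈ Finset.range m, Q a) := by
    simp only [f, Polynomial.map_sub, Polynomial.map_sum, Polynomial.map_mul, hprod, map_C,
      Polynomial.map_pow, map_X, add_zero, Int.coe_castRingHom]
    ring
  simp only [hS₁, hmap2, iterate_euler_operator_sub, hS₂, iterate_euler_operator_sum,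
    iterate_euler_operator_X_pow, eval_sub, eval_mul, eval_pow, eval_finsetSum, eval_C, eval_X,
    eval_one, hS₂' rfl, hQ1, sub_self, one_pow, mul_one, zero_pow hm0, zero_mul, pow_zero,
    one_mul] at hD
  have hsum : ∑ j ∈ Finset.range p,
      ((quadraticChar (ZMod p) (j : ZMod p) : ℤ) : ZMod p) * (j : ZMod p) ^ m = -1 := by
    have h1 : ∀ j ∈ Finset.range p,
        ((quadraticChar (ZMod p) (j : ZMod p) : ℤ) : ZMod p) * (j : ZMod p) ^ m =
          if j = 0 then 0 else 1 := by
      intro j hj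
      rw [mem_range] at hj
      rw [quadraticChar_eq_pow_of_char_ne_two' hchar, ZMod.card, ← hmdef, ← pow_add, ← two_mul]
      split_ifs with h0
      · simp [h0, hm0]
      · have : (j : ZMod p) ≠ 0 := by
          rw [Ne, ZMod.natCast_eq_zero_iff]
          exact fun hd => h0 (Nat.eq_zero_of_dvd_of_lt hd hj)
        rw [show 2 * m = p - 1 by omega, ZMod.pow_card_sub_one_eq_one this]
    rw [sum_congr rfl h1]
    have h3 : Finset.range p = insert 0 (Finset.Ioo 0 p) := by
      ext j
      have := hp.pos
      simp
      omega
    rw [h3, sum_insert (by simp), sum_congr rfl (g := fun _ => (1 : ZMod p))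
      (fun j hj => if_neg (mem_Ioo.mp hj).1.ne')]
    simp [Nat.cast_sub hp.one_le]
  rw [hsum] at hD
  have hfac := factorial_half_sq p hp2
  rw [← hmdef] at hfac
  have h8 := legendreSym.at_neg_two hp2
  have h9 := legendreSym.eq_pow p (-2)
  rw [h8, ← hmdef] at h9
  push_cast at h9
  have hne : (-1 : ZMod p) ≠ 1 := Ring.neg_one_ne_one_of_char_ne_two hchar
  have h10 : (ε : ZMod p) * ((ZMod.χ₈' p : ℤ) : ZMod p) = 1 := by
    rw [h9, show (-2 : ZMod p) = (-1) * 2 by ring, mul_pow]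
    linear_combination hD + (ε : ZMod p) * 2 ^ m * hfac
  have h11 : ZMod.χ₈' (p : ZMod 8) = 1 ∨ ZMod.χ₈' (p : ZMod 8) = -1 := by
    rw [← h8]
    apply quadraticChar_dichotomy
    have h2 : (2 : ZMod p) ≠ 0 := Ring.two_ne_zero hchar
    simpa using h2
  rcases hε with rfl | rfl <;> rcases h11 with h' | h' <;> rw [h'] at h10 ⊢
  · simp at h10
    exact absurd h10 hne
  · simp at h10
    exact absurd h10 hne

theorem norm_halfProd_sq (hp2 : p ≠ 2) {ζ : ℂ} (hζ : IsPrimitiveRoot ζ p) :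
    ‖(halfProd p ℂ).eval ζ‖ ^ 2 = p := by
  have hp : p.Prime := Fact.out
  have hodd := hp.odd_of_ne_two hp2
  obtain ⟨m, hm⟩ : ∃ m, p = 2 * m + 1 := hodd
  have hm' : p / 2 = m := by omega
  have hζ1 : ‖ζ‖ = 1 := hζ.norm'_eq_one hp.ne_zero
  have hω : IsPrimitiveRoot (ζ ^ 2) (m + m + 1) := by
    have := hζ.pow_of_coprime 2 ((Nat.coprime_primes Nat.prime_two hp).mpr hp2.symm)
    convert this using 1
    omega
  have h1 : ‖(halfProd p ℂ).eval ζ‖ = ∏ a ∈ Finset.range m, ‖1 - (ζ ^ 2) ^ (a + 1)‖ := by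
    rw [halfProd, eval_prod, norm_prod, hm']
    refine prod_congr rfl fun a ha => ?_
    rw [mem_range] at ha
    have h2 : ζ ^ (a + 1) - ζ ^ (p - (a + 1)) = -ζ ^ (p - (a + 1)) * (1 - (ζ ^ 2) ^ (a + 1)) := by
      have h3 : ζ ^ (p - (a + 1)) * (ζ ^ 2) ^ (a + 1) = ζ ^ (a + 1) := by
        rw [← pow_mul, ← pow_add, show p - (a + 1) + 2 * (a + 1) = p + (a + 1) by omega, pow_add,
          hζ.pow_eq_one, one_mul]
      linear_combination -h3
    simp [h2, hζ1]
  have h4 := congrArg norm hω.prod_one_sub_pow_eq_order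
  rw [norm_prod, prod_range_add] at h4
  have h5 : ∏ a ∈ Finset.range m, ‖1 - (ζ ^ 2) ^ (m + a + 1)‖ =
      ∏ a ∈ Finset.range m, ‖1 - (ζ ^ 2) ^ (a + 1)‖ := by
    rw [← prod_range_reflect]
    refine prod_congr rfl fun a ha => ?_
    rw [mem_range] at ha
    have h6 : (ζ ^ 2) ^ (m + (m - 1 - a) + 1) * (ζ ^ 2) ^ (a + 1) = 1 := by
      rw [← pow_add, show m + (m - 1 - a) + 1 + (a + 1) = m + m + 1 by omega, hω.pow_eq_one]
    have h7 : 1 - (ζ ^ 2) ^ (m + (m - 1 - a) + 1) =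
        -(ζ ^ 2) ^ (m + (m - 1 - a) + 1) * (1 - (ζ ^ 2) ^ (a + 1)) := by
      linear_combination -h6
    rw [h7]
    simp [hζ1]
  rw [h5, ← sq, ← h1] at h4
  rw [h4, hm]
  have : ((m + m : ℕ) : ℂ) + 1 = ((2 * m + 1 : ℕ) : ℂ) := by push_cast; ring
  rw [this, Complex.norm_natCast]

theorem halfProd_eval (hp2 : p ≠ 2) :
    (halfProd p ℂ).eval (Complex.exp (2 * Real.pi * Complex.I / p)) =
      Complex.I ^ (p / 2) * (Real.sqrt p : ℂ) := by
  have hp : p.Prime := Fact.out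
  have hp0 : (0 : ℝ) < p := by exact_mod_cast hp.pos
  have hζ := Complex.isPrimitiveRoot_exp p hp.ne_zero
  set ζ := Complex.exp (2 * Real.pi * Complex.I / p) with hζdef
  have hfac : ∀ a ∈ Finset.range (p / 2), ζ ^ (a + 1) - ζ ^ (p - (a + 1)) =
      Complex.I * ((2 * Real.sin (2 * Real.pi * (a + 1) / p) : ℝ) : ℂ) := by
    intro a ha
    rw [mem_range] at ha
    have h1 : ζ ^ (p - (a + 1)) = (ζ ^ (a + 1))⁻¹ := by
      rw [pow_sub₀ ζ (hζ.ne_zero hp.ne_zero) (by omega), hζ.pow_eq_one, one_mul]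
    have h2 : ζ ^ (a + 1) = Complex.exp ((2 * Real.pi * (a + 1) / p : ℝ) * Complex.I) := by
      rw [hζdef, ← Complex.exp_nat_mul]
      congr 1
      push_cast
      ring
    rw [h1, h2, ← Complex.exp_neg, Complex.ofReal_mul, Complex.ofReal_sin, Complex.sin]
    push_cast
    rw [neg_mul]
    linear_combination (Complex.exp (2 * Real.pi * (a + 1) / p * Complex.I) -
      Complex.exp (-(2 * Real.pi * (a + 1) / p * Complex.I))) * Complex.I_sq
  set A := ∏ a ∈ Finset.range (p / 2), (2 * Real.sin (2 * Real.pi * (a + 1) / p)) with hA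
  have hApos : 0 < A := by
    refine prod_pos fun a ha => mul_pos two_pos (Real.sin_pos_of_pos_of_lt_pi (by positivity) ?_)
    rw [mem_range] at ha
    have hlt : 2 * ((a : ℝ) + 1) < p := by
      have hodd := hp.odd_of_ne_two hp2
      have : 2 * (a + 1) < p := by obtain ⟨k, hk⟩ := hodd; omega
      exact_mod_cast this
    rw [div_lt_iff₀ hp0]
    nlinarith [Real.pi_pos]
  have hP : (halfProd p ℂ).eval ζ = Complex.I ^ (p / 2) * (A : ℂ) := by
    rw [halfProd, eval_prod, hA, Complex.ofReal_prod]
    simp only [eval_sub, eval_pow, eval_X]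
    rw [prod_congr rfl hfac, prod_mul_distrib, prod_const, card_range]
  have hn := norm_halfProd_sq p hp2 hζ
  rw [hP] at hn ⊢
  rw [norm_mul, norm_pow, Complex.norm_I, one_pow, one_mul, Complex.norm_of_nonneg hApos.le] at hn
  rw [← hn, Real.sqrt_sq hApos.le]

/-- Gauss's evaluation of the quadratic Gauss sum over a prime field. -/
theorem quadratic_gaussSum_zmod (hp2 : p ≠ 2) :
    ∑ x : ZMod p, (quadraticChar (ZMod p) x : ℂ) * ZMod.stdAddChar x =
      if p % 4 = 1 then (Real.sqrt p : ℂ) else Complex.I * (Real.sqrt p : ℂ) := by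
  have hp : p.Prime := Fact.out
  have hodd := hp.odd_of_ne_two hp2
  have hp1 : p % 2 = 1 := Nat.odd_iff.mp hodd
  have hchar : ringChar (ZMod p) ≠ 2 := by rwa [ZMod.ringChar_zmod_n]
  have hζ := Complex.isPrimitiveRoot_exp p hp.ne_zero
  set G := ∑ x : ZMod p, (quadraticChar (ZMod p) x : ℂ) * ZMod.stdAddChar x with hG
  have hGrange : ∑ j ∈ Finset.range p, (quadraticChar (ZMod p) (j : ZMod p) : ℂ) *
      Complex.exp (2 * Real.pi * Complex.I / p) ^ j = G := by
    rw [hG]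
    refine sum_bij' (fun j _ => (j : ZMod p)) (fun x _ => x.val) ?_ ?_ ?_ ?_ ?_
    · simp
    · intro x _
      exact mem_range.mpr x.val_lt
    · intro j hj
      exact ZMod.val_cast_of_lt (mem_range.mp hj)
    · simp
    · intro j _
      have := ZMod.stdAddChar_coe (N := p) j
      rw [Int.cast_natCast] at this
      rw [this, ← Complex.exp_nat_mul]
      congr 2
      push_cast
      ring
  have hsqrt : ((Real.sqrt p : ℝ) : ℂ) ^ 2 = p := by
    rw [← Complex.ofReal_pow, Real.sq_sqrt (Nat.cast_nonneg p), Complex.ofReal_natCast]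
  have hGsq : G ^ 2 = (Complex.I ^ (p / 2) * (Real.sqrt p : ℂ)) ^ 2 := by
    have h1 : (quadraticChar (ZMod p)).ringHomComp (Int.castRingHom ℂ) ≠ 1 :=
      (MulChar.ringHomComp_ne_one_iff (RingHom.injective_int _)).mpr (quadraticChar_ne_one hchar)
    have h2 := gaussSum_sq h1 ((quadraticChar_isQuadratic (ZMod p)).comp _)
      (ZMod.isPrimitive_stdAddChar p)
    simp only [gaussSum, MulChar.ringHomComp_apply, eq_intCast, ZMod.card,
      quadraticChar_neg_one hchar, ZMod.χ₄_eq_neg_one_pow hp1] at h2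
    rw [hG, h2, mul_pow, hsqrt, ← pow_mul, mul_comm (p / 2), pow_mul, Complex.I_sq]
    simp
  obtain ⟨ε, hε, hGε⟩ : ∃ ε : ℤ, (ε = 1 ∨ ε = -1) ∧
      G = ε * (Complex.I ^ (p / 2) * (Real.sqrt p : ℂ)) := by
    rcases sq_eq_sq_iff_eq_or_eq_neg.mp hGsq with h | h
    · exact ⟨1, Or.inl rfl, by simpa using h⟩
    · exact ⟨-1, Or.inr rfl, by simpa using h⟩
  have hsign := sign_of_gaussSum_eq p hp2 hζ hε (by rw [hGrange, halfProd_eval p hp2, hGε])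
  have hp8 : p % 8 = 1 ∨ p % 8 = 3 ∨ p % 8 = 5 ∨ p % 8 = 7 := by omega
  have hcast : (p : ZMod 8) = ((p % 8 : ℕ) : ZMod 8) := by simp
  have hI : Complex.I ^ (p / 2) = Complex.I ^ (p / 2 % 4) := Complex.I_pow_eq_pow_mod _
  rw [hGε, hsign, hcast, hI]
  rcases hp8 with h | h | h | h
  · rw [h, show p / 2 % 4 = 0 by omega, if_pos (by omega),
      show ZMod.χ₈' ((1 : ℕ) : ZMod 8) = 1 from rfl]
    simp
  · rw [h, show p / 2 % 4 = 1 by omega, if_neg (by omega),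
      show ZMod.χ₈' ((3 : ℕ) : ZMod 8) = 1 from rfl]
    simp
  · rw [h, show p / 2 % 4 = 2 by omega, if_pos (by omega),
      show ZMod.χ₈' ((5 : ℕ) : ZMod 8) = -1 from rfl]
    simp
  · rw [h, show p / 2 % 4 = 3 by omega, if_neg (by omega),
      show ZMod.χ₈' ((7 : ℕ) : ZMod 8) = -1 from rfl]
    simp [Complex.I_pow_three]

end GaussSign

theorem mulChar_eq_quadraticChar {F : Type*} [Field F] [Fintype F] [DecidableEq F]
    {η : MulChar F ℂ} (hη : η ≠ 1)
    (hval : ∀ x : F, η x = 0 ∨ η x = 1 ∨ η x = -1) (x : F) :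
    η x = (quadraticChar F x : ℂ) := by
  have hunit : ∀ y : F, y ≠ 0 → η y = 1 ∨ η y = -1 := fun y hy =>
    (hval y).resolve_left ((hy.isUnit.map η).ne_zero)
  have hsq : ∀ y : F, y ≠ 0 → IsSquare y → η y = 1 := by
    rintro _ hy ⟨z, rfl⟩
    rw [map_mul]
    rcases hunit z (left_ne_zero_of_mul hy) with h | h <;> rw [h] <;> norm_num
  obtain ⟨u, hu⟩ := MulChar.ne_one_iff.mp hη
  have hu' : η u = -1 := (hunit u u.ne_zero).resolve_left hu
  have hus : quadraticChar F u = -1 := by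
    rw [quadraticChar_neg_one_iff_not_isSquare]
    exact fun h => hu (hsq u u.ne_zero h)
  rcases eq_or_ne x 0 with rfl | hx
  · simp [η.map_zero]
  rcases quadraticChar_dichotomy hx with h | h
  · rw [h, hsq x hx ((quadraticChar_one_iff_isSquare hx).mp h)]
    simp
  · have h1 : quadraticChar F (u * x) = 1 := by rw [map_mul, hus, h]; rfl
    have h2 := hsq _ (mul_ne_zero u.ne_zero hx)
      ((quadraticChar_one_iff_isSquare (mul_ne_zero u.ne_zero hx)).mp h1)
    rw [map_mul, hu'] at h2
    rw [h]
    push_cast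
    linear_combination -h2

/-- For the quadratic character `η` of `F_{p^r}` (`p` an odd prime):
if `p ≡ 1 (mod 4)` then `G(η,1) = -(-1)^r √(p^r)`, and
if `p ≡ 3 (mod 4)` then `G(η,1) = -(-i)^r √(p^r)`. -/
theorem statement13 (p r : ℕ) (hp : p.Prime) (hodd : Odd p) (hr : 1 ≤ r)
    (F : Type*) [Field F] [Fintype F] [Algebra (ZMod p) F]
    (hF : Fintype.card F = p ^ r)
    (η : MulChar F ℂ) (hη : η ≠ 1) (hval : ∀ x : F, η x = 0 ∨ η x = 1 ∨ η x = -1) :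
    (p % 4 = 1 →
      ∑ x : F, η x * eChar p F x = -(-1 : ℂ) ^ r * (Real.sqrt ((p : ℝ) ^ r) : ℂ))
    ∧ (p % 4 = 3 →
      ∑ x : F, η x * eChar p F x = -(-Complex.I) ^ r * (Real.sqrt ((p : ℝ) ^ r) : ℂ)) := by
  have : Fact p.Prime := ⟨hp⟩
  classical
  have hp2 : p ≠ 2 := by
    rintro rfl
    exact absurd hodd (by decide)
  have hK : ringChar (ZMod p) ≠ 2 := by rwa [ZMod.ringChar_zmod_n]
  have hchar : ringChar F ≠ 2 := by rwa [← Algebra.ringChar_eq (ZMod p) F]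
  have hfin : Module.finrank (ZMod p) F = r := by
    have h := Module.card_eq_pow_finrank (K := ZMod p) (V := F)
    rw [hF, ZMod.card] at h
    exact (Nat.pow_right_injective hp.two_le h).symm
  obtain ⟨n, rfl⟩ : ∃ n, r = n + 1 := ⟨r - 1, by omega⟩
  have hsum : ∑ x : F, η x * eChar p F x = (-1) ^ n *
      (∑ x : ZMod p, (quadraticChar (ZMod p) x : ℂ) * ZMod.stdAddChar x) ^ (n + 1) := by
    rw [← quadratic_davenport_hasse hK (ZMod.isPrimitive_stdAddChar p) hfin]
    refine Finset.sum_congr rfl fun x _ => ?_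
    rw [mulChar_eq_quadraticChar hη hval, ZMod.stdAddChar_apply, ZMod.toCircle_apply, eChar]
  have hsqrt : (Real.sqrt ((p : ℝ) ^ (n + 1)) : ℂ) = (Real.sqrt p : ℂ) ^ (n + 1) := by
    rw [← Complex.ofReal_pow, Real.sqrt_eq_rpow, Real.sqrt_eq_rpow, ← Real.rpow_natCast,
      ← Real.rpow_natCast, ← Real.rpow_mul (Nat.cast_nonneg p),
      ← Real.rpow_mul (Nat.cast_nonneg p), mul_comm]
  rw [hsum, quadratic_gaussSum_zmod p hp2, hsqrt]
  constructor
  · intro h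
    rw [if_pos h, pow_succ (-1 : ℂ)]
    ring
  · intro h
    rw [if_neg (by omega), mul_pow, neg_pow Complex.I, pow_succ (-1 : ℂ)]
    ring
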